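/- Fix s ∈ S and a right coset decomposition G = ∪_{i=1}^k G_s g_i with g_1 = 1. Assume each α_t (t ∈ S) restricted to G_t is a normal cocycle, and assume α_{s g_i}(g_j⁻¹ h g_i, g_i⁻¹ a g_i) = α_{s g_i}(g_j⁻¹ h a h⁻¹ g_j, g_j⁻¹ h g_i) for all 1 ≤ i,j ≤ k, all h ∈ G_s and all α_s-regular a ∈ G_s. Let L_1,...,L_r be the α_s-regular conjugacy classes of G_s. Then the r elements Z(L_t) = Σ_{a∈L_t} Σ_{i=1}^k (g_i⁻¹ a g_i) ⊗ e(s·g_i), 1 ≤ t ≤ r, form a C-basis of the center Z(D(O_s)) of the algebra D(O_s). -/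

import Mathlib

/-- The multiplication of the generalized twisted double `A_α(G,S)`, realized on
`(G × S) →₀ ℂ` with basis `{g ⊗ e(s)}`:
`(g⊗e(s))·(h⊗e(t)) = α_t(g,h)·(gh ⊗ e(s·h)e(t))`. -/
noncomputable def gtdMul {G S : Type*} [Group G] [Fintype S] [DecidableEq S]
    (act : S → G → S) (α : G → G → S → ℂˣ)
    (a b : (G × S) →₀ ℂ) : (G × S) →₀ ℂ :=
  a.sum fun p c => b.sum fun q d =>
    if act p.2 q.1 = q.2 then
      Finsupp.single (p.1 * q.1, q.2) (c * d * (α p.1 q.1 q.2 : ℂ))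
    else 0

/-- `a` in the stabilizer `G_t` is `α_t`-regular. -/
def IsRegAt {G S : Type*} [Group G] (act : S → G → S) (α : G → G → S → ℂˣ)
    (t : S) (a : G) : Prop :=
  ∀ z : G, act t z = t → z * a = a * z → α a z t = α z a t

/-- The span of the basis vectors lying over the orbit of `s` consists of the vectors
supported over that orbit. -/
theorem mem_span_orbit_iff {G S : Type*} (act : S → G → S) (s : S) (w : (G × S) →₀ ℂ) :
    w ∈ Submodule.span ℂ
        {v : (G × S) →₀ ℂ | ∃ a x : G, v = Finsupp.single (a, act s x) (1 : ℂ)} ↔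
      ∀ a u, w (a, u) ≠ 0 → ∃ x, u = act s x := by
  have h : {v : (G × S) →₀ ℂ | ∃ a x : G, v = Finsupp.single (a, act s x) (1 : ℂ)} =
      (fun p => Finsupp.single p (1 : ℂ)) '' {p : G × S | ∃ x, p.2 = act s x} := by
    ext v
    constructor
    · rintro ⟨a, x, rfl⟩
      exact ⟨(a, act s x), ⟨x, rfl⟩, rfl⟩
    · rintro ⟨⟨a, u⟩, ⟨x, hx⟩, rfl⟩
      exact ⟨a, x, by simp only at hx; rw [hx]⟩
  rw [h, ← Finsupp.supported_eq_span_single, Finsupp.mem_supported]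
  constructor
  · intro hw a u hau
    exact hw (by simpa using hau)
  · rintro hw ⟨a, u⟩ hau
    exact hw a u (by simpa using hau)

/-- The coefficients of the sum attached to a finite subset `L` of the stabilizer. -/
theorem sum_conj_single_apply {G S : Type*} [Group G] [DecidableEq G] [DecidableEq S]
    (act : S → G → S) (s : S) {k : ℕ} (g : Fin k → G)
    (hinj : Function.Injective fun i => act s (g i)) (L : Finset G) (b : G) (i : Fin k) :
    (∑ a ∈ L, ∑ j : Fin k, Finsupp.single ((g j)⁻¹ * a * g j, act s (g j)) (1 : ℂ))
      (b, act s (g i)) = if g i * b * (g i)⁻¹ ∈ L then 1 else 0 := by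
  rw [Finsupp.finsetSum_apply, ← Finset.sum_ite_eq' L (g i * b * (g i)⁻¹) fun _ => (1 : ℂ)]
  refine Finset.sum_congr rfl fun a _ => ?_
  rw [Finsupp.finsetSum_apply, Finset.sum_eq_single i]
  · rw [Finsupp.single_apply]
    congr 1
    simp only [Prod.mk.injEq, and_true, eq_iff_iff]
    constructor
    · rintro rfl; group
    · rintro rfl; group
  · intro j _ hj
    rw [Finsupp.single_apply, if_neg]
    intro h
    exact hj (hinj (Prod.mk.inj h).2)
  · simp

theorem sum_conj_single_apply_of_forall_ne {G S : Type*} [Group G]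
    (act : S → G → S) (s : S) {k : ℕ} (g : Fin k → G) (L : Finset G)
    (b : G) (u : S) (hu : ∀ i, u ≠ act s (g i)) :
    (∑ a ∈ L, ∑ j : Fin k, Finsupp.single ((g j)⁻¹ * a * g j, act s (g j)) (1 : ℂ))
      (b, u) = 0 := by
  classical
  rw [Finsupp.finsetSum_apply]
  refine Finset.sum_eq_zero fun a _ => ?_
  rw [Finsupp.finsetSum_apply]
  refine Finset.sum_eq_zero fun j _ => ?_
  rw [Finsupp.single_apply, if_neg]
  intro h
  exact hu j (Prod.mk.inj h).2.symm

section GtdMul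

variable {G S : Type*} [Group G] [Fintype S] [DecidableEq S]
  (act : S → G → S) (α : G → G → S → ℂˣ)

theorem gtdMul_zero (a : (G × S) →₀ ℂ) : gtdMul act α a 0 = 0 := by
  simp [gtdMul, Finsupp.sum]

theorem zero_gtdMul (a : (G × S) →₀ ℂ) : gtdMul act α 0 a = 0 := by
  simp [gtdMul]

theorem gtdMul_add (a b c : (G × S) →₀ ℂ) :
    gtdMul act α a (b + c) = gtdMul act α a b + gtdMul act α a c := by
  classical
  unfold gtdMul
  rw [← Finsupp.sum_add]
  refine Finsupp.sum_congr fun p _ => ?_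
  refine Finsupp.sum_add_index' (fun q => by simp) fun q d e => ?_
  split_ifs
  · rw [← Finsupp.single_add]; congr 1; ring
  · simp

theorem add_gtdMul (a b c : (G × S) →₀ ℂ) :
    gtdMul act α (a + b) c = gtdMul act α a c + gtdMul act α b c := by
  classical
  unfold gtdMul
  refine Finsupp.sum_add_index' (fun p => by simp) fun p d e => ?_
  rw [← Finsupp.sum_add]
  refine Finsupp.sum_congr fun q _ => ?_
  split_ifs
  · rw [← Finsupp.single_add]; congr 1; ring
  · simp

theorem gtdMul_smul (r : ℂ) (a b : (G × S) →₀ ℂ) :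
    gtdMul act α a (r • b) = r • gtdMul act α a b := by
  classical
  unfold gtdMul
  rw [Finsupp.smul_sum]
  refine Finsupp.sum_congr fun p _ => ?_
  rw [Finsupp.sum_smul_index (by simp), Finsupp.smul_sum]
  refine Finsupp.sum_congr fun q _ => ?_
  split_ifs
  · rw [Finsupp.smul_single, smul_eq_mul]; congr 1; ring
  · simp

theorem smul_gtdMul (r : ℂ) (a b : (G × S) →₀ ℂ) :
    gtdMul act α (r • a) b = r • gtdMul act α a b := by
  classical
  unfold gtdMul
  rw [Finsupp.sum_smul_index (by simp), Finsupp.smul_sum]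
  refine Finsupp.sum_congr fun p _ => ?_
  rw [Finsupp.smul_sum]
  refine Finsupp.sum_congr fun q _ => ?_
  split_ifs
  · rw [Finsupp.smul_single, smul_eq_mul]; congr 1; ring
  · simp

theorem gtdMul_single_single (a x : G) (t u : S) (c : ℂ) :
    gtdMul act α (Finsupp.single (a, t) c) (Finsupp.single (x, u) 1) =
      if act t x = u then Finsupp.single (a * x, u) (c * (α a x u : ℂ)) else 0 := by
  unfold gtdMul
  rw [Finsupp.sum_single_index (by simp), Finsupp.sum_single_index (by simp)]
  simp

theorem gtdMul_single_single' (a x : G) (t u : S) (c : ℂ) :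
    gtdMul act α (Finsupp.single (x, u) 1) (Finsupp.single (a, t) c) =
      if act u a = t then Finsupp.single (x * a, t) (c * (α x a t : ℂ)) else 0 := by
  unfold gtdMul
  rw [Finsupp.sum_single_index (by simp), Finsupp.sum_single_index (by simp)]
  simp

theorem gtdMul_single_apply
    (hact1 : ∀ s : S, act s 1 = s)
    (hact : ∀ (s : S) (g h : G), act (act s g) h = act s (g * h))
    (w : (G × S) →₀ ℂ) (x b : G) (u v : S) :
    gtdMul act α w (Finsupp.single (x, u) 1) (b, v) =
      if v = u then w (b * x⁻¹, act u x⁻¹) * (α (b * x⁻¹) x u : ℂ) else 0 := by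
  classical
  induction w using Finsupp.induction_linear with
  | zero => simp [zero_gtdMul]
  | add f g hf hg =>
    rw [add_gtdMul, Finsupp.add_apply, hf, hg]
    split_ifs <;> simp [add_mul]
  | single p c =>
    obtain ⟨a, t⟩ := p
    have h1 : act t x = u ↔ t = act u x⁻¹ := by
      constructor
      · rintro rfl; simp [hact, hact1]
      · rintro rfl; simp [hact, hact1]
    have h2 : a * x = b ↔ a = b * x⁻¹ := eq_mul_inv_iff_mul_eq.symm
    rw [gtdMul_single_single]
    by_cases ht : t = act u x⁻¹
    · rw [if_pos (h1.2 ht)]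
      simp only [Finsupp.single_apply, Prod.mk.injEq, h2, ← ht, and_true, eq_comm (a := u)]
      by_cases hv : v = u <;> by_cases ha : a = b * x⁻¹ <;> simp [hv, ha]
    · rw [if_neg (fun h => ht (h1.1 h))]
      simp [ht]

theorem single_gtdMul_apply (w : (G × S) →₀ ℂ) (x b : G) (u v : S) :
    gtdMul act α (Finsupp.single (x, u) 1) w (b, v) =
      if act u (x⁻¹ * b) = v then w (x⁻¹ * b, v) * (α x (x⁻¹ * b) v : ℂ) else 0 := by
  classical
  induction w using Finsupp.induction_linear with
  | zero => simp [gtdMul_zero]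
  | add f g hf hg =>
    rw [gtdMul_add, Finsupp.add_apply, hf, hg]
    split_ifs <;> simp [add_mul]
  | single p c =>
    obtain ⟨a, t⟩ := p
    have h2 : x * a = b ↔ a = x⁻¹ * b := eq_inv_mul_iff_mul_eq.symm
    rw [gtdMul_single_single']
    by_cases ha : a = x⁻¹ * b
    · subst ha
      by_cases ht : t = v
      · subst ht
        split_ifs <;> simp
      · split_ifs <;> simp [ht]
    · split_ifs <;> simp [ha, h2]

/-- Coefficientwise description of the center of `D(O_s)`. -/
theorem central_iff
    (hact1 : ∀ s : S, act s 1 = s)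
    (hact : ∀ (s : S) (g h : G), act (act s g) h = act s (g * h))
    (hα1 : ∀ (g : G) (s : S), α g 1 s = 1)
    (s : S) (w : (G × S) →₀ ℂ) :
    (w ∈ Submodule.span ℂ
        {v : (G × S) →₀ ℂ | ∃ a x : G, v = Finsupp.single (a, act s x) (1 : ℂ)} ∧
      ∀ v ∈ Submodule.span ℂ
          {v : (G × S) →₀ ℂ | ∃ a x : G, v = Finsupp.single (a, act s x) (1 : ℂ)},
        gtdMul act α w v = gtdMul act α v w) ↔
      (∀ a u, w (a, u) ≠ 0 → (∃ y, u = act s y) ∧ act u a = u) ∧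
      ∀ a x y, act (act s y) a = act s y →
        w (x * a * x⁻¹, act (act s y) x⁻¹) * (α (x * a * x⁻¹) x (act s y) : ℂ) =
          w (a, act s y) * (α x a (act s y) : ℂ) := by
  rw [mem_span_orbit_iff]
  constructor
  · rintro ⟨hsupp, hcomm⟩
    have key : ∀ (x y b : G) (v : S),
        (if v = act s y then w (b * x⁻¹, act (act s y) x⁻¹) *
          (α (b * x⁻¹) x (act s y) : ℂ) else 0) =
        if act (act s y) (x⁻¹ * b) = v then
          w (x⁻¹ * b, v) * (α x (x⁻¹ * b) v : ℂ) else 0 := by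
      intro x y b v
      rw [← gtdMul_single_apply act α hact1 hact, ← single_gtdMul_apply,
        hcomm _ (Submodule.subset_span ⟨x, y, rfl⟩)]
    refine ⟨fun a u hau => ?_, fun a x y ha => ?_⟩
    · obtain ⟨y, rfl⟩ := hsupp a u hau
      refine ⟨⟨y, rfl⟩, ?_⟩
      by_contra hne
      have h := key 1 y a (act s y)
      simp only [inv_one, mul_one, one_mul, hact1, hα1, hne, if_true, if_false,
        Units.val_one] at h
      exact hau h
    · have h := key x y (x * a) (act s y)
      simpa [ha] using h
  · rintro ⟨hsupp, hstar⟩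
    refine ⟨fun a u h => (hsupp a u h).1, fun v hv => ?_⟩
    induction hv using Submodule.span_induction with
    | zero => rw [gtdMul_zero, zero_gtdMul]
    | add a b _ _ ha hb => rw [gtdMul_add, add_gtdMul, ha, hb]
    | smul r a _ ha => rw [gtdMul_smul, smul_gtdMul, ha]
    | mem v hv =>
      obtain ⟨x, y, rfl⟩ := hv
      ext ⟨b, v⟩
      rw [gtdMul_single_apply act α hact1 hact, single_gtdMul_apply]
      by_cases hv : v = act s y
      · subst hv
        rw [if_pos rfl]
        by_cases hb : act (act s y) (x⁻¹ * b) = act s y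
        · rw [if_pos hb]
          simpa using hstar (x⁻¹ * b) x y hb
        · rw [if_neg hb, mul_eq_zero]
          left
          by_contra hw
          have h := (hsupp _ _ hw).2
          apply hb
          have h' := congrArg (fun t => act t x) h
          simpa [hact, hact1, mul_assoc] using h'
      · rw [if_neg hv]
        split_ifs with hb
        · symm
          rw [mul_eq_zero]
          left
          by_contra hw
          have h := (hsupp _ _ hw).2
          apply hv
          have h' := congrArg (fun t => act t (x⁻¹ * b)⁻¹) (h.trans hb.symm)
          simpa only [hact, hact1, mul_inv_cancel, mul_inv_cancel_right] using h'
        · rfl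

end GtdMul

/-- Fix `s ∈ S` and a right coset decomposition `G = ∪_{i=1}^k G_s g_i`, `g_1 = 1`.
Under the normality and compatibility assumptions on `α`, if `L_1,…,L_r` are the
`α_s`-regular conjugacy classes of `G_s`, then the `r` elements
`Z(L_t) = ∑_{a∈L_t} ∑_{i=1}^k (g_i⁻¹ a g_i) ⊗ e(s·g_i)` form a `ℂ`-basis of the
center `Z(D(O_s))` of `D(O_s)`. -/
theorem stmt15 {G S : Type*} [Group G] [Fintype S] [DecidableEq S]
    (act : S → G → S)
    (hact1 : ∀ s : S, act s 1 = s)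
    (hact : ∀ (s : S) (g h : G), act (act s g) h = act s (g * h))
    (α : G → G → S → ℂˣ)
    (hα1 : ∀ (g : G) (s : S), α g 1 s = 1) (hα1' : ∀ (g : G) (s : S), α 1 g s = 1)
    (hαc : ∀ (g h l : G) (s : S),
      α (g * h) l s * α g h (act s l⁻¹) = α g (h * l) s * α h l s)
    (s : S) (k : ℕ) [NeZero k] (g : Fin k → G) (hg1 : g 0 = 1)
    (hcoset : ∀ x : G, ∃! i : Fin k, act s x = act s (g i))
    (hnorm : ∀ (t : S) (x a : G), act t x = t → act t a = t → IsRegAt act α t a →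
      α x a t = α (x * a * x⁻¹) x t)
    (hcompat : ∀ (i j : Fin k) (h a : G), act s h = s → act s a = s →
      IsRegAt act α s a →
      α ((g j)⁻¹ * h * g i) ((g i)⁻¹ * a * g i) (act s (g i))
        = α ((g j)⁻¹ * (h * a * h⁻¹) * g j) ((g j)⁻¹ * h * g i) (act s (g i)))
    -- `L 1, …, L r` are the `α_s`-regular conjugacy classes of `G_s`
    (r : ℕ) (L : Fin r → Finset G)
    (hLs : ∀ t, ∀ a ∈ L t, act s a = s)
    (hLreg : ∀ t, ∀ a ∈ L t, IsRegAt act α s a)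
    (hLconj : ∀ t, ∃ a₀ ∈ L t, ∀ b : G,
      b ∈ L t ↔ ∃ h : G, act s h = s ∧ b = h * a₀ * h⁻¹)
    (hLdisj : ∀ t t' : Fin r, t ≠ t' → Disjoint (L t) (L t'))
    (hLcover : ∀ a : G, act s a = s → IsRegAt act α s a → ∃ t, a ∈ L t) :
    -- the `Z(L_t)` are linearly independent and span exactly the center of `D(O_s)`
    LinearIndependent ℂ (fun t : Fin r => ∑ a ∈ L t, ∑ i : Fin k,
      Finsupp.single ((g i)⁻¹ * a * g i, act s (g i)) (1 : ℂ)) ∧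
    ∀ w : (G × S) →₀ ℂ,
      (w ∈ Submodule.span ℂ
          {v : (G × S) →₀ ℂ | ∃ a x : G, v = Finsupp.single (a, act s x) (1 : ℂ)} ∧
        ∀ v ∈ Submodule.span ℂ
            {v : (G × S) →₀ ℂ | ∃ a x : G, v = Finsupp.single (a, act s x) (1 : ℂ)},
          gtdMul act α w v = gtdMul act α v w) ↔
      w ∈ Submodule.span ℂ
        (Set.range fun t : Fin r => ∑ a ∈ L t, ∑ i : Fin k,
          Finsupp.single ((g i)⁻¹ * a * g i, act s (g i)) (1 : ℂ)) := by
  classical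
  have hinj : Function.Injective fun i => act s (g i) := fun i j hij =>
    (hcoset (g i)).unique rfl hij
  set Z : Fin r → (G × S) →₀ ℂ := fun t => ∑ a ∈ L t, ∑ i : Fin k,
    Finsupp.single ((g i)⁻¹ * a * g i, act s (g i)) (1 : ℂ) with hZ
  have hZapp : ∀ t b i, Z t (b, act s (g i)) = if g i * b * (g i)⁻¹ ∈ L t then 1 else 0 :=
    fun t b i => sum_conj_single_apply act s g hinj (L t) b i
  have hZzero : ∀ t b u, (∀ i, u ≠ act s (g i)) → Z t (b, u) = 0 :=
    fun t b u hu => sum_conj_single_apply_of_forall_ne act s g (L t) b u hu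
  have hZapp0 : ∀ t b, Z t (b, s) = if b ∈ L t then 1 else 0 := fun t b => by
    simpa [hg1, hact1] using hZapp t b 0
  have hsinv : ∀ {h : G}, act s h = s → act s h⁻¹ = s := fun {h} hh => by
    conv_lhs => rw [← hh]
    rw [hact, mul_inv_cancel, hact1]
  choose a₀ ha₀ hLmem using hLconj
  have hLconj_mem : ∀ t {h a : G}, act s h = s → a ∈ L t → h * a * h⁻¹ ∈ L t := by
    intro t h a hh ha
    obtain ⟨h', hh', rfl⟩ := (hLmem t a).1 ha
    exact (hLmem t _).2 ⟨h * h', by rw [← hact, hh, hh'], by group⟩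
  have hLconj_iff : ∀ t {h a : G}, act s h = s → (h * a * h⁻¹ ∈ L t ↔ a ∈ L t) := by
    intro t h a hh
    refine ⟨fun ha => ?_, hLconj_mem t hh⟩
    have := hLconj_mem t (hsinv hh) ha
    simpa [mul_assoc] using this
  have hLuniq : ∀ {t t' a}, a ∈ L t → a ∈ L t' → t = t' := by
    intro t t' a ha ha'
    by_contra hne
    exact Finset.disjoint_left.1 (hLdisj t t' hne) ha ha'
  have hcombo : ∀ (c : Fin r → ℂ) t, (∑ t', c t' • Z t') (a₀ t, s) = c t := by
    intro c t
    rw [Finsupp.finsetSum_apply, Finset.sum_eq_single t]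
    · simp [hZapp0, ha₀]
    · intro t' _ hne
      have : a₀ t ∉ L t' := fun h => hne (hLuniq h (ha₀ t))
      simp [hZapp0, this]
    · simp
  refine ⟨?_, fun w => ?_⟩
  · rw [Fintype.linearIndependent_iff]
    intro c hc t
    rw [← hcombo c t, hc]
    rfl
  rw [central_iff act α hact1 hact hα1]
  constructor
  · rintro ⟨hsupp, hstar⟩
    have hmove : ∀ (i : Fin k) (b : G), act s b = s →
        w ((g i)⁻¹ * b * g i, act s (g i)) *
          (α ((g i)⁻¹ * b * g i) (g i)⁻¹ s : ℂ) = w (b, s) * (α (g i)⁻¹ b s : ℂ) := by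
      intro i b hb
      simpa [hact1, hb] using hstar b (g i)⁻¹ 1 (by simp [hact1, hb])
    have hreg : ∀ b, w (b, s) ≠ 0 → IsRegAt act α s b := by
      intro b hb z hz hzb
      have h := hstar b z 1 (by rw [hact1]; exact (hsupp b s hb).2)
      rw [hact1, hzb, mul_inv_cancel_right, hsinv hz] at h
      exact Units.ext (mul_left_cancel₀ hb h)
    have hinv : ∀ (i : Fin k) (h a : G), act s h = s → act s a = s → IsRegAt act α s a →
        w ((g i)⁻¹ * (h * a * h⁻¹) * g i, act s (g i)) = w (a, s) := by
      intro i h a hh ha hr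
      have h1 := hstar a ((g i)⁻¹ * h) 1 (by rw [hact1]; exact ha)
      have e1 : (g i)⁻¹ * h * a * ((g i)⁻¹ * h)⁻¹ = (g i)⁻¹ * (h * a * h⁻¹) * g i := by group
      have e2 : act s ((g i)⁻¹ * h)⁻¹ = act s (g i) := by
        rw [mul_inv_rev, inv_inv, ← hact, hsinv hh]
      have h2 := hcompat 0 i h a hh ha hr
      simp only [hg1, hact1, inv_one, mul_one, one_mul] at h2
      rw [hact1, e1, e2, h2] at h1
      exact mul_right_cancel₀ (Units.ne_zero _) h1
    have hw : w = ∑ t, w (a₀ t, s) • Z t := by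
      ext ⟨b, u⟩
      by_cases hu : ∃ i, u = act s (g i)
      · obtain ⟨i, rfl⟩ := hu
        rw [Finsupp.finsetSum_apply]
        simp only [Finsupp.smul_apply, hZapp, smul_eq_mul]
        set b' := g i * b * (g i)⁻¹ with hb'
        have hbb : b = (g i)⁻¹ * b' * g i := by rw [hb']; group
        by_cases hmem : ∃ t, b' ∈ L t
        · obtain ⟨t, ht⟩ := hmem
          rw [Finset.sum_eq_single t]
          · rw [if_pos ht, mul_one, hbb]
            obtain ⟨h, hh, hbh⟩ := (hLmem t b').1 ht
            rw [hbh]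
            exact hinv i h (a₀ t) hh (hLs t _ (ha₀ t)) (hLreg t _ (ha₀ t))
          · intro t' _ hne
            rw [if_neg fun h => hne (hLuniq h ht), mul_zero]
          · simp
        · rw [Finset.sum_eq_zero fun t _ => by rw [if_neg fun h => hmem ⟨t, h⟩, mul_zero]]
          by_contra hne
          have hstab : act s b' = s := by
            have h := congrArg (fun t => act t (g i)⁻¹) (hsupp _ _ hne).2
            simpa [hact, hact1, hb', mul_assoc] using h
          have hne' : w (b', s) ≠ 0 := by
            intro h0
            have h := hmove i b' hstab
            rw [h0, zero_mul, ← hbb] at h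
            exact mul_ne_zero hne (Units.ne_zero _) h
          exact hmem (hLcover b' hstab (hreg b' hne'))
      · push Not at hu
        have h0 : w (b, u) = 0 := by
          by_contra hne
          obtain ⟨y, hy⟩ := (hsupp b u hne).1
          obtain ⟨i, hi, -⟩ := hcoset y
          exact hu i (hy.trans hi)
        rw [h0, Finsupp.finsetSum_apply, Finset.sum_eq_zero]
        intro t _
        rw [Finsupp.smul_apply, hZzero t b u hu, smul_zero]
    rw [hw]
    exact Submodule.sum_mem _ fun t _ =>
      Submodule.smul_mem _ _ (Submodule.subset_span ⟨t, rfl⟩)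
  · rw [← central_iff act α hact1 hact hα1]
    intro hw
    have hZc := fun t => (central_iff act α hact1 hact hα1 s (Z t)).2 (by
      refine ⟨fun a u hau => ?_, fun a x y ha => ?_⟩
      · by_cases hu : ∃ i, u = act s (g i)
        · obtain ⟨i, rfl⟩ := hu
          refine ⟨⟨_, rfl⟩, ?_⟩
          rw [hZapp] at hau
          have hmem : g i * a * (g i)⁻¹ ∈ L t := by
            by_contra h
            exact hau (if_neg h)
          have h := congrArg (fun t => act t (g i)) (hLs t _ hmem)
          simpa [hact, mul_assoc] using h
        · push Not at hu
          exact absurd (hZzero t a u hu) hau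
      · obtain ⟨i, hi, -⟩ := hcoset y
        obtain ⟨j, hj, -⟩ := hcoset (y * x⁻¹)
        rw [hact, hj, hi, hZapp, hZapp]
        set h := g j * x * (g i)⁻¹ with hh
        have hstab : act s h = s := by
          rw [hh, ← hact, ← hact, ← hj, hact s, inv_mul_cancel_right, hi, hact,
            mul_inv_cancel, hact1]
        have e1 : g j * (x * a * x⁻¹) * (g j)⁻¹ = h * (g i * a * (g i)⁻¹) * h⁻¹ := by
          rw [hh]; group
        simp only [e1, hLconj_iff t hstab]
        split_ifs with hmem
        · have hc := hcompat i j h _ hstab (hLs t _ hmem) (hLreg t _ hmem)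
          rw [← e1] at hc
          have e2 : (g j)⁻¹ * h * g i = x := by rw [hh]; group
          have e3 : (g i)⁻¹ * (g i * a * (g i)⁻¹) * g i = a := by group
          have e4 : (g j)⁻¹ * (g j * (x * a * x⁻¹) * (g j)⁻¹) * g j = x * a * x⁻¹ := by group
          rw [e2, e3, e4] at hc
          rw [hc]
        · simp)
    refine ⟨Submodule.span_le.2 ?_ hw, fun v hv => ?_⟩
    · rintro _ ⟨t, rfl⟩
      exact (hZc t).1
    · induction hw using Submodule.span_induction with
      | zero => rw [gtdMul_zero, zero_gtdMul]
      | add a b _ _ ha hb => rw [gtdMul_add, add_gtdMul, ha, hb]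
      | smul r a _ ha => rw [gtdMul_smul, smul_gtdMul, ha]
      | mem a ha =>
        obtain ⟨t, rfl⟩ := ha
        exact (hZc t).2 v hv
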